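/- If there is an ALC concept of size at most k' = n + k + 2 that fits P = {(I,a)}, N = {(J,b)}, then {S_1,…,S_m} has a hitting set of size at most k. -/

import Mathlib

open scoped ENNReal

namespace ALCPaper

/-- ALC concepts; concept names and role names are natural numbers. -/
inductive ALC : Type
  | bot
  | top
  | atom (A : ℕ)
  | neg (c : ALC)
  | inter (c d : ALC)
  | union (c d : ALC)
  | all (r : ℕ) (c : ALC)
  | ex (r : ℕ) (c : ALC)
  deriving DecidableEq

/-- An interpretation: a domain of natural numbers, extensions of concept names,
and extensions of role names. -/
structure Interp where
  dom : Set ℕ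
  cI : ℕ → Set ℕ
  rI : ℕ → Set (ℕ × ℕ)

/-- Well-formedness of an interpretation: the domain is nonempty, concept name
extensions are subsets of the domain and role name extensions are binary relations
on the domain. -/
def Interp.WF (I : Interp) : Prop :=
  I.dom.Nonempty ∧ (∀ A, I.cI A ⊆ I.dom) ∧
    ∀ r, ∀ p ∈ I.rI r, p.1 ∈ I.dom ∧ p.2 ∈ I.dom

/-- The extension `C^I` of a concept `C` in an interpretation `I`. -/
def ALC.sem : ALC → Interp → Set ℕ
  | .bot, _ => ∅
  | .top, I => I.dom
  | .atom A, I => I.cI A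
  | .neg c, I => I.dom \ c.sem I
  | .inter c d, I => c.sem I ∩ d.sem I
  | .union c d, I => c.sem I ∪ d.sem I
  | .all r c, I => {d | d ∈ I.dom ∧ ∀ e, (d, e) ∈ I.rI r → e ∈ c.sem I}
  | .ex r c, I => {d | ∃ e, (d, e) ∈ I.rI r ∧ e ∈ c.sem I}

/-- The size of a concept: the number of nodes of its syntax tree. -/
def ALC.size : ALC → ℕ
  | .bot => 1
  | .top => 1
  | .atom _ => 1
  | .neg c => c.size + 1
  | .inter c d => c.size + d.size + 1
  | .union c d => c.size + d.size + 1
  | .all _ c => c.size + 1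
  | .ex _ c => c.size + 1

/-- The quantifier depth of a concept: the nesting depth of ∃/∀. -/
def ALC.qdepth : ALC → ℕ
  | .bot => 0
  | .top => 0
  | .atom _ => 0
  | .neg c => c.qdepth
  | .inter c d => max c.qdepth d.qdepth
  | .union c d => max c.qdepth d.qdepth
  | .all _ c => c.qdepth + 1
  | .ex _ c => c.qdepth + 1

/-- The concept names occurring in a concept. -/
def ALC.conceptNames : ALC → Finset ℕ
  | .bot => ∅
  | .top => ∅
  | .atom A => {A}
  | .neg c => c.conceptNames
  | .inter c d => c.conceptNames ∪ d.conceptNames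
  | .union c d => c.conceptNames ∪ d.conceptNames
  | .all _ c => c.conceptNames
  | .ex _ c => c.conceptNames

/-- The role names occurring in a concept. -/
def ALC.roleNames : ALC → Finset ℕ
  | .bot => ∅
  | .top => ∅
  | .atom _ => ∅
  | .neg c => c.roleNames
  | .inter c d => c.roleNames ∪ d.roleNames
  | .union c d => c.roleNames ∪ d.roleNames
  | .all r c => insert r c.roleNames
  | .ex r c => insert r c.roleNames

/-- The five constructors ¬, ⊓, ⊔, ∀, ∃. -/
inductive Op : Type
  | neg | inter | union | all | ex
  deriving DecidableEq

/-- Membership in the fragment L(O): the concept is built from ⊤, ⊥ and concept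
names using only constructors from O. -/
def ALC.InLang (O : Set Op) : ALC → Prop
  | .bot => True
  | .top => True
  | .atom _ => True
  | .neg c => Op.neg ∈ O ∧ c.InLang O
  | .inter c d => Op.inter ∈ O ∧ c.InLang O ∧ d.InLang O
  | .union c d => Op.union ∈ O ∧ c.InLang O ∧ d.InLang O
  | .all _ c => Op.all ∈ O ∧ c.InLang O
  | .ex _ c => Op.ex ∈ O ∧ c.InLang O

/-- The dual of a constructor. -/
def Op.dual : Op → Op
  | .neg => .neg
  | .inter => .union
  | .union => .inter
  | .all => .ex
  | .ex => .all

/-- The dual concept C̄. -/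
def ALC.dual : ALC → ALC
  | .bot => .top
  | .top => .bot
  | .atom A => .atom A
  | .neg c => .neg c.dual
  | .inter c d => .union c.dual d.dual
  | .union c d => .inter c.dual d.dual
  | .all r c => .ex r c.dual
  | .ex r c => .all r c.dual

open Classical in
/-- The interpretation Ī_Σ obtained by complementing the extensions of the concept
names in Σ (here `S` is the set of concept names of the signature Σ). -/
noncomputable def Interp.dualWrt (I : Interp) (S : Set ℕ) : Interp where
  dom := I.dom
  cI := fun A => if A ∈ S then I.dom \ I.cI A else I.cI A
  rI := I.rI

/-- A pointed interpretation. -/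
abbrev Ex : Type := Interp × ℕ

/-- A finite interpretation: finite domain and only finitely many concept and role
names with nonempty extension. -/
def Interp.FiniteI (I : Interp) : Prop :=
  I.dom.Finite ∧ {A | (I.cI A).Nonempty}.Finite ∧ {r | (I.rI r).Nonempty}.Finite

/-- An example: a finite (well-formed) interpretation with a distinguished domain
element. -/
def IsExample (e : Ex) : Prop := e.1.WF ∧ e.1.FiniteI ∧ e.2 ∈ e.1.dom

/-- The dual example (Ī_Σ, a). -/
noncomputable def dualEx (S : Set ℕ) (e : Ex) : Ex := (e.1.dualWrt S, e.2)

/-- `C` fits the positive examples `P` and the negative examples `N`. -/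
def Fits (C : ALC) (P N : Set Ex) : Prop :=
  (∀ e ∈ P, e.2 ∈ C.sem e.1) ∧ ∀ e ∈ N, e.2 ∉ C.sem e.1

/-- Subsumption C ⊑ D: `C^I ⊆ D^I` for every interpretation `I`. -/
def Subsume (C D : ALC) : Prop := ∀ I : Interp, I.WF → C.sem I ⊆ D.sem I

/-- Equivalence of concepts. -/
def CEquiv (C D : ALC) : Prop := Subsume C D ∧ Subsume D C

/-- The concept names occurring in (the facts of) a set of examples. -/
def exCNames (E : Set Ex) : Set ℕ := {A | ∃ e ∈ E, (e.1.cI A).Nonempty}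

/-- The role names occurring in (the facts of) a set of examples. -/
def exRNames (E : Set Ex) : Set ℕ := {r | ∃ e ∈ E, (e.1.rI r).Nonempty}

/-! Encoding of the domain elements used in the hitting-set reduction.
Tags < 7 together with `Nat.pair` give an injective encoding into ℕ. -/

def el (tag j i : ℕ) : ℕ := tag + 7 * Nat.pair j i

/-- the root `b` of `J` -/
def eB : ℕ := el 0 0 0
/-- the element `b_{j,i}` -/
def eBB (j i : ℕ) : ℕ := el 1 j i
/-- the element `b'_{j,i}` -/
def eBB' (j i : ℕ) : ℕ := el 2 j i
/-- the sink `c` -/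
def eC : ℕ := el 3 0 0
/-- the root `a` of `I` -/
def eA : ℕ := el 4 0 0
/-- the element `a_i` -/
def eAA (i : ℕ) : ℕ := el 5 0 i
/-- the element `a'_i` -/
def eAA' (i : ℕ) : ℕ := el 6 0 i

/-- The r-edges of `J` not involving the root `b`. -/
def JrCore (m n : ℕ) (S : ℕ → Set ℕ) : Set (ℕ × ℕ) :=
  {p | ∃ j i, 1 ≤ j ∧ j ≤ m ∧ 1 ≤ i ∧ i ≤ n ∧ p = (eBB j (i - 1), eBB j i)} ∪
  {p | ∃ j i, 1 ≤ j ∧ j ≤ m ∧ 1 ≤ i ∧ i ≤ n ∧ i ∉ S j ∧ p = (eBB' j i, eC)} ∪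
  {p | ∃ j, 1 ≤ j ∧ j ≤ m ∧ p = (eBB j n, eC)} ∪ {(eC, eC)}

/-- The r-edges of `J`. -/
def JrPairs (m n : ℕ) (S : ℕ → Set ℕ) : Set (ℕ × ℕ) :=
  {p | ∃ j, 1 ≤ j ∧ j ≤ m ∧ p = (eB, eBB j 0)} ∪ JrCore m n S

/-- The s-edges of `J` (none of them involves the root `b`). -/
def JsPairs (m n : ℕ) (S : ℕ → Set ℕ) : Set (ℕ × ℕ) :=
  {p | ∃ j i, 1 ≤ j ∧ j ≤ m ∧ 1 ≤ i ∧ i ≤ n ∧ i ∉ S j ∧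
      (p = (eBB j (i - 1), eBB' j i) ∨ p = (eBB' j i, eBB j i))} ∪
  {p | ∃ j i, 1 ≤ j ∧ j ≤ m ∧ 1 ≤ i ∧ i ≤ n ∧ i ∈ S j ∧ p = (eBB j (i - 1), eC)} ∪
  {p | ∃ j, 1 ≤ j ∧ j ≤ m ∧ p = (eBB j n, eC)} ∪ {(eC, eC)}

/-- The domain of `J`. -/
def Jdom (m n : ℕ) (S : ℕ → Set ℕ) : Set ℕ :=
  {eB} ∪ {x | ∃ j i, 1 ≤ j ∧ j ≤ m ∧ i ≤ n ∧ x = eBB j i} ∪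
  {x | ∃ j i, 1 ≤ j ∧ j ≤ m ∧ 1 ≤ i ∧ i ≤ n ∧ i ∉ S j ∧ x = eBB' j i} ∪ {eC}

/-- The interpretation `J` of the reduction; concept name `A` is 0, role names
`r`, `s` are 0 and 1. -/
def Jinterp (m n : ℕ) (S : ℕ → Set ℕ) : Interp where
  dom := Jdom m n S
  cI := fun A => if A = 0 then {x | ∃ j, 1 ≤ j ∧ j ≤ m ∧ x = eBB j n} else ∅
  rI := fun ρ => if ρ = 0 then JrPairs m n S else if ρ = 1 then JsPairs m n S else ∅

/-- The domain of `I`: `J` without `b`, extended by `a`, `a_0, …, a_n` and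
`a'_1, …, a'_n`. -/
def Idom (m n : ℕ) (S : ℕ → Set ℕ) : Set ℕ :=
  (Jdom m n S \ {eB}) ∪ {eA} ∪ {x | ∃ i, i ≤ n ∧ x = eAA i} ∪
  {x | ∃ i, 1 ≤ i ∧ i ≤ n ∧ x = eAA' i}

/-- The r-edges of `I`. -/
def IrPairs (m n : ℕ) (S : ℕ → Set ℕ) : Set (ℕ × ℕ) :=
  JrCore m n S ∪ {(eA, eAA 0)} ∪ {p | ∃ j, 1 ≤ j ∧ j ≤ m ∧ p = (eA, eBB j 0)} ∪
  {p | ∃ i, 1 ≤ i ∧ i ≤ n ∧ p = (eAA (i - 1), eAA i)} ∪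
  {p | ∃ i, 1 ≤ i ∧ i ≤ n ∧ p = (eAA' i, eC)} ∪ {(eAA n, eC)}

/-- The s-edges of `I`. -/
def IsPairs (m n : ℕ) (S : ℕ → Set ℕ) : Set (ℕ × ℕ) :=
  JsPairs m n S ∪
  {p | ∃ i, 1 ≤ i ∧ i ≤ n ∧ (p = (eAA (i - 1), eAA' i) ∨ p = (eAA' i, eAA i))} ∪
  {(eAA n, eC)}

/-- The interpretation `I` of the reduction. -/
def Iinterp (m n : ℕ) (S : ℕ → Set ℕ) : Interp where
  dom := Idom m n S
  cI := fun A =>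
    if A = 0 then {x | ∃ j, 1 ≤ j ∧ j ≤ m ∧ x = eBB j n} ∪ {eAA n} else ∅
  rI := fun ρ => if ρ = 0 then IrPairs m n S else if ρ = 1 then IsPairs m n S else ∅

/-- The concepts `C_i` built from a hitting set `H`: `C_0 = A` and
`C_i = ∃s.∃s.C_{i-1}` if `n − i + 1 ∈ H`, `C_i = ∃r.C_{i-1}` otherwise. -/
def hsConcept (H : Finset ℕ) (n : ℕ) : ℕ → ALC
  | 0 => .atom 0
  | i + 1 => if n - i ∈ H then .ex 1 (.ex 1 (hsConcept H n i)) else .ex 0 (hsConcept H n i)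

/-- `chainA [t₁, …, t_ℓ]` is the concept `∃t₁.….∃t_ℓ.A`. -/
def chainA : List ℕ → ALC
  | [] => .atom 0
  | t :: ts => .ex t (chainA ts)


theorem el_inj {t j i t' j' i' : ℕ} (h : t < 7) (h' : t' < 7) :
    el t j i = el t' j' i' ↔ t = t' ∧ j = j' ∧ i = i' := by
  unfold el
  constructor
  · intro e
    have h1 : t = t' := by omega
    have h2 : Nat.pair j i = Nat.pair j' i' := by omega
    exact ⟨h1, Nat.pair_eq_pair.1 h2⟩
  · rintro ⟨rfl, rfl, rfl⟩; rfl

/-- `y` is the unique `t`-successor of `x`. -/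
def USucc (I : Interp) (t x y : ℕ) : Prop := ∀ e, (x, e) ∈ I.rI t ↔ e = y

section
variable (m n : ℕ) (S : ℕ → Set ℕ)

theorem rA {i : ℕ} (hi : i < n) : USucc (Iinterp m n S) 0 (eAA i) (eAA (i+1)) := by
  intro e
  simp [Iinterp, IrPairs, JrCore, eBB, eBB', eC, eA, eAA, eAA', el_inj, Prod.ext_iff]
  grind

theorem rAn : USucc (Iinterp m n S) 0 (eAA n) eC := by
  intro e
  simp [Iinterp, IrPairs, JrCore, eBB, eBB', eC, eA, eAA, eAA', el_inj, Prod.ext_iff]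
  grind

theorem rA' {i : ℕ} (h1 : 1 ≤ i) (hi : i ≤ n) : USucc (Iinterp m n S) 0 (eAA' i) eC := by
  intro e
  simp [Iinterp, IrPairs, JrCore, eBB, eBB', eC, eA, eAA, eAA', el_inj, Prod.ext_iff]
  grind

theorem rC : USucc (Iinterp m n S) 0 eC eC := by
  intro e
  simp [Iinterp, IrPairs, JrCore, eBB, eBB', eC, eA, eAA, eAA', el_inj, Prod.ext_iff]

theorem rB {j i : ℕ} (hj : 1 ≤ j) (hj' : j ≤ m) (hi : i < n) :
    USucc (Iinterp m n S) 0 (eBB j i) (eBB j (i+1)) := by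
  intro e
  simp [Iinterp, IrPairs, JrCore, eBB, eBB', eC, eA, eAA, eAA', el_inj, Prod.ext_iff]
  grind

theorem rBn {j : ℕ} (hj : 1 ≤ j) (hj' : j ≤ m) :
    USucc (Iinterp m n S) 0 (eBB j n) eC := by
  intro e
  simp [Iinterp, IrPairs, JrCore, eBB, eBB', eC, eA, eAA, eAA', el_inj, Prod.ext_iff]
  grind

theorem rB' {j i : ℕ} (hj : 1 ≤ j) (hj' : j ≤ m) (h1 : 1 ≤ i) (hi : i ≤ n) (hS : i ∉ S j) :
    USucc (Iinterp m n S) 0 (eBB' j i) eC := by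
  intro e
  simp [Iinterp, IrPairs, JrCore, eBB, eBB', eC, eA, eAA, eAA', el_inj, Prod.ext_iff]
  grind

theorem sA {i : ℕ} (hi : i < n) : USucc (Iinterp m n S) 1 (eAA i) (eAA' (i+1)) := by
  intro e
  simp [Iinterp, IsPairs, JsPairs, eBB, eBB', eC, eA, eAA, eAA', el_inj, Prod.ext_iff]
  grind

theorem sAn : USucc (Iinterp m n S) 1 (eAA n) eC := by
  intro e
  simp [Iinterp, IsPairs, JsPairs, eBB, eBB', eC, eA, eAA, eAA', el_inj, Prod.ext_iff]
  grind

theorem sA' {i : ℕ} (h1 : 1 ≤ i) (hi : i ≤ n) : USucc (Iinterp m n S) 1 (eAA' i) (eAA i) := by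
  intro e
  simp [Iinterp, IsPairs, JsPairs, eBB, eBB', eC, eA, eAA, eAA', el_inj, Prod.ext_iff]
  grind

theorem sC : USucc (Iinterp m n S) 1 eC eC := by
  intro e
  simp [Iinterp, IsPairs, JsPairs, eBB, eBB', eC, eA, eAA, eAA', el_inj, Prod.ext_iff]

theorem sB {j i : ℕ} (hj : 1 ≤ j) (hj' : j ≤ m) (hi : i < n) (hS : i + 1 ∉ S j) :
    USucc (Iinterp m n S) 1 (eBB j i) (eBB' j (i+1)) := by
  intro e
  simp [Iinterp, IsPairs, JsPairs, eBB, eBB', eC, eA, eAA, eAA', el_inj, Prod.ext_iff]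
  grind

theorem sBc {j i : ℕ} (hj : 1 ≤ j) (hj' : j ≤ m) (hi : i < n) (hS : i + 1 ∈ S j) :
    USucc (Iinterp m n S) 1 (eBB j i) eC := by
  intro e
  simp [Iinterp, IsPairs, JsPairs, eBB, eBB', eC, eA, eAA, eAA', el_inj, Prod.ext_iff]
  grind

theorem sBn {j : ℕ} (hj : 1 ≤ j) (hj' : j ≤ m) :
    USucc (Iinterp m n S) 1 (eBB j n) eC := by
  intro e
  simp [Iinterp, IsPairs, JsPairs, eBB, eBB', eC, eA, eAA, eAA', el_inj, Prod.ext_iff]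
  grind

theorem sB' {j i : ℕ} (hj : 1 ≤ j) (hj' : j ≤ m) (h1 : 1 ≤ i) (hi : i ≤ n) (hS : i ∉ S j) :
    USucc (Iinterp m n S) 1 (eBB' j i) (eBB j i) := by
  intro e
  simp [Iinterp, IsPairs, JsPairs, eBB, eBB', eC, eA, eAA, eAA', el_inj, Prod.ext_iff]
  grind

theorem dA {i : ℕ} (hi : i ≤ n) : eAA i ∈ (Iinterp m n S).dom := by
  simp [Iinterp, Idom, Jdom, eB, eBB, eBB', eC, eA, eAA, eAA', el_inj, hi]
theorem dA' {i : ℕ} (h1 : 1 ≤ i) (hi : i ≤ n) : eAA' i ∈ (Iinterp m n S).dom := by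
  simp [Iinterp, Idom, Jdom, eB, eBB, eBB', eC, eA, eAA, eAA', el_inj, hi, h1]
theorem dC : eC ∈ (Iinterp m n S).dom := by
  simp [Iinterp, Idom, Jdom, eB, eBB, eBB', eC, eA, eAA, eAA', el_inj]
theorem dB {j i : ℕ} (hj : 1 ≤ j) (hj' : j ≤ m) (hi : i ≤ n) :
    eBB j i ∈ (Iinterp m n S).dom := by
  simp [Iinterp, Idom, Jdom, eB, eBB, eBB', eC, eA, eAA, eAA', el_inj, hj, hj', hi]
theorem dB' {j i : ℕ} (hj : 1 ≤ j) (hj' : j ≤ m) (h1 : 1 ≤ i) (hi : i ≤ n) (hS : i ∉ S j) :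
    eBB' j i ∈ (Iinterp m n S).dom := by
  simp [Iinterp, Idom, Jdom, eB, eBB, eBB', eC, eA, eAA, eAA', el_inj, hj, hj', hi, h1, hS]

/-- Abstract "modal step": `G` behaves like a quantifier over `t` applied to `D`. -/
def Modal (I : Interp) (t : ℕ) (D G : ALC) : Prop :=
  (∀ x y, x ∈ I.dom → USucc I t x y → (x ∈ G.sem I ↔ y ∈ D.sem I)) ∧ G.size = D.size + 1

theorem modal_ex (I : Interp) (t : ℕ) (D : ALC) : Modal I t D (.ex t D) := by
  refine ⟨fun x y _ h => ?_, rfl⟩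
  simp [ALC.sem, h _]

theorem modal_all (I : Interp) (t : ℕ) (D : ALC) : Modal I t D (.all t D) := by
  refine ⟨fun x y hx h => ?_, rfl⟩
  simp [ALC.sem, h _, hx]

/-- The lower bound claim. -/
structure Cl (D : ALC) : Prop where
  ac : ∀ i ≤ n, ¬ (eAA i ∈ D.sem (Iinterp m n S) ↔ eC ∈ D.sem (Iinterp m n S)) →
    n + 1 ≤ D.size + i
  ac' : ∀ i, 1 ≤ i → i ≤ n →
    ¬ (eAA' i ∈ D.sem (Iinterp m n S) ↔ eC ∈ D.sem (Iinterp m n S)) → n + 2 ≤ D.size + i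
  ab : ∀ i ≤ n, ∀ T : Set ℕ, T.Nonempty → (∀ j ∈ T, 1 ≤ j ∧ j ≤ m) →
    (∀ j ∈ T, ¬ (eAA i ∈ D.sem (Iinterp m n S) ↔ eBB j i ∈ D.sem (Iinterp m n S))) →
    ∃ H : Finset ℕ, (∀ j ∈ T, ∃ x ∈ H, x ∈ S j) ∧ n + 1 + H.card ≤ D.size + i
  ab' : ∀ i, 1 ≤ i → i ≤ n → ∀ T : Set ℕ, T.Nonempty →
    (∀ j ∈ T, (1 ≤ j ∧ j ≤ m) ∧ i ∉ S j) →
    (∀ j ∈ T, ¬ (eAA' i ∈ D.sem (Iinterp m n S) ↔ eBB' j i ∈ D.sem (Iinterp m n S))) →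
    ∃ H : Finset ℕ, (∀ j ∈ T, ∃ x ∈ H, x ∈ S j) ∧ n + 2 + H.card ≤ D.size + i

variable {m n S}

/-- Concepts constant on the relevant elements satisfy the claim. -/
theorem cl_const (D : ALC) (p : Prop) (h : ∀ x ∈ (Iinterp m n S).dom, x ≠ eA →
    (x ∈ D.sem (Iinterp m n S) ↔ p)) : Cl m n S D := by
  have nA : ∀ i, eAA i ≠ eA := fun i => by simp [eAA, eA, el_inj]
  have nA' : ∀ i, eAA' i ≠ eA := fun i => by simp [eAA', eA, el_inj]
  have nC : eC ≠ eA := by simp [eC, eA, el_inj]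
  have nB : ∀ j i, eBB j i ≠ eA := fun j i => by simp [eBB, eA, el_inj]
  have nB' : ∀ j i, eBB' j i ≠ eA := fun j i => by simp [eBB', eA, el_inj]
  refine ⟨?_, ?_, ?_, ?_⟩
  · intro i hi hd
    rw [h _ (dA m n S hi) (nA _), h _ (dC m n S) nC] at hd
    exact absurd Iff.rfl hd
  · intro i h1 hi hd
    rw [h _ (dA' m n S h1 hi) (nA' _), h _ (dC m n S) nC] at hd
    exact absurd Iff.rfl hd
  · rintro i hi T ⟨j, hj⟩ hT hd
    have := hd j hj
    rw [h _ (dA m n S hi) (nA _), h _ (dB m n S (hT j hj).1 (hT j hj).2 hi) (nB _ _)] at this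
    exact absurd Iff.rfl this
  · rintro i h1 hi T ⟨j, hj⟩ hT hd
    have := hd j hj
    rw [h _ (dA' m n S h1 hi) (nA' _),
      h _ (dB' m n S (hT j hj).1.1 (hT j hj).1.2 h1 hi (hT j hj).2) (nB' _ _)] at this
    exact absurd Iff.rfl this

theorem cl_atom (a : ℕ) : Cl m n S (.atom a) := by
  by_cases ha : a = 0
  · subst ha
    refine ⟨?_, ?_, ?_, ?_⟩
    · intro i hi
      simp [ALC.sem, ALC.size, Iinterp, eBB, eC, eAA, el_inj]
      omega
    · intro i h1 hi
      simp [ALC.sem, Iinterp, eBB, eC, eAA, eAA', el_inj]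
    · rintro i hi T ⟨j, hj⟩ hT hd
      have := hd j hj
      exfalso; apply this
      have := hT j hj
      simp [ALC.sem, Iinterp, eBB, eAA, el_inj]
      grind
    · rintro i h1 hi T ⟨j, hj⟩ hT hd
      have := hd j hj
      exfalso; apply this
      simp [ALC.sem, Iinterp, eBB, eBB', eAA, eAA', el_inj]
  · exact cl_const _ False (by simp [ALC.sem, Iinterp, ha])

theorem cl_neg {D : ALC} (h : Cl m n S D) : Cl m n S (.neg D) := by
  have key : ∀ x y, x ∈ (Iinterp m n S).dom → y ∈ (Iinterp m n S).dom →
      ¬ (x ∈ (ALC.neg D).sem (Iinterp m n S) ↔ y ∈ (ALC.neg D).sem (Iinterp m n S)) →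
      ¬ (x ∈ D.sem (Iinterp m n S) ↔ y ∈ D.sem (Iinterp m n S)) := by
    intro x y hx hy
    simp [ALC.sem, hx, hy]; tauto
  refine ⟨?_, ?_, ?_, ?_⟩
  · intro i hi hd
    have := h.ac i hi (key _ _ (dA m n S hi) (dC m n S) hd)
    simp only [ALC.size]; omega
  · intro i h1 hi hd
    have := h.ac' i h1 hi (key _ _ (dA' m n S h1 hi) (dC m n S) hd)
    simp only [ALC.size]; omega
  · intro i hi T hne hT hd
    obtain ⟨H, h1, h2⟩ := h.ab i hi T hne hT fun j hj =>
      key _ _ (dA m n S hi) (dB m n S (hT j hj).1 (hT j hj).2 hi) (hd j hj)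
    exact ⟨H, h1, by simp only [ALC.size]; omega⟩
  · intro i h1 hi T hne hT hd
    obtain ⟨H, h1, h2⟩ := h.ab' i h1 hi T hne hT fun j hj =>
      key _ _ (dA' m n S h1 hi) (dB' m n S (hT j hj).1.1 (hT j hj).1.2 h1 hi (hT j hj).2) (hd j hj)
    exact ⟨H, h1, by simp only [ALC.size]; omega⟩

theorem combine {T : Set ℕ} (hne : T.Nonempty) {p q : ℕ → Prop} (hpq : ∀ j ∈ T, p j ∨ q j)
    {N s1 s2 i : ℕ} (hi : i ≤ N)
    (h1 : {j ∈ T | p j}.Nonempty →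
      ∃ H : Finset ℕ, (∀ j ∈ {j ∈ T | p j}, ∃ x ∈ H, x ∈ S j) ∧ N + H.card ≤ s1 + i)
    (h2 : {j ∈ T | q j}.Nonempty →
      ∃ H : Finset ℕ, (∀ j ∈ {j ∈ T | q j}, ∃ x ∈ H, x ∈ S j) ∧ N + H.card ≤ s2 + i) :
    ∃ H : Finset ℕ, (∀ j ∈ T, ∃ x ∈ H, x ∈ S j) ∧ N + H.card ≤ s1 + s2 + 1 + i := by
  by_cases e1 : {j ∈ T | p j}.Nonempty
  · obtain ⟨H1, a1, b1⟩ := h1 e1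
    by_cases e2 : {j ∈ T | q j}.Nonempty
    · obtain ⟨H2, a2, b2⟩ := h2 e2
      refine ⟨H1 ∪ H2, ?_, ?_⟩
      · intro j hj
        rcases hpq j hj with h | h
        · obtain ⟨x, hx, hx'⟩ := a1 j ⟨hj, h⟩
          exact ⟨x, Finset.mem_union_left _ hx, hx'⟩
        · obtain ⟨x, hx, hx'⟩ := a2 j ⟨hj, h⟩
          exact ⟨x, Finset.mem_union_right _ hx, hx'⟩
      · have := Finset.card_union_le H1 H2
        omega
    · refine ⟨H1, fun j hj => ?_, by omega⟩
      rcases hpq j hj with h | h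
      · exact a1 j ⟨hj, h⟩
      · exact absurd ⟨j, hj, h⟩ e2
  · have e2 : {j ∈ T | q j}.Nonempty := by
      obtain ⟨j, hj⟩ := hne
      rcases hpq j hj with h | h
      · exact absurd ⟨j, hj, h⟩ e1
      · exact ⟨j, hj, h⟩
    obtain ⟨H2, a2, b2⟩ := h2 e2
    refine ⟨H2, fun j hj => ?_, by omega⟩
    rcases hpq j hj with h | h
    · exact absurd ⟨j, hj, h⟩ e1
    · exact a2 j ⟨hj, h⟩

theorem cl_bin {D E G : ALC} (hD : Cl m n S D) (hE : Cl m n S E)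
    (hs : G.size = D.size + E.size + 1)
    (key : ∀ x y, ¬ (x ∈ G.sem (Iinterp m n S) ↔ y ∈ G.sem (Iinterp m n S)) →
      ¬ (x ∈ D.sem (Iinterp m n S) ↔ y ∈ D.sem (Iinterp m n S)) ∨
      ¬ (x ∈ E.sem (Iinterp m n S) ↔ y ∈ E.sem (Iinterp m n S))) : Cl m n S G := by
  refine ⟨?_, ?_, ?_, ?_⟩
  · intro i hi hd
    rcases key _ _ hd with h | h
    · have := hD.ac i hi h; omega
    · have := hE.ac i hi h; omega
  · intro i h1 hi hd
    rcases key _ _ hd with h | h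
    · have := hD.ac' i h1 hi h; omega
    · have := hE.ac' i h1 hi h; omega
  · intro i hi T hne hT hd
    rw [hs]
    exact combine hne (fun j hj => key _ _ (hd j hj)) (by omega)
      (fun e => hD.ab i hi _ e (fun j hj => hT j hj.1) (fun j hj => hj.2))
      (fun e => hE.ab i hi _ e (fun j hj => hT j hj.1) (fun j hj => hj.2))
  · intro i h1 hi T hne hT hd
    rw [hs]
    exact combine hne (fun j hj => key _ _ (hd j hj)) (by omega)
      (fun e => hD.ab' i h1 hi _ e (fun j hj => hT j hj.1) (fun j hj => hj.2))
      (fun e => hE.ab' i h1 hi _ e (fun j hj => hT j hj.1) (fun j hj => hj.2))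

theorem cl_r {D G : ALC} (hD : Cl m n S D) (hG : Modal (Iinterp m n S) 0 D G) :
    Cl m n S G := by
  obtain ⟨hG, hs⟩ := hG
  refine ⟨?_, ?_, ?_, ?_⟩
  · intro i hi hd
    rw [hG _ _ (dC m n S) (rC m n S)] at hd
    rcases hi.lt_or_eq with hlt | rfl
    · rw [hG _ _ (dA m n S hi) (rA m n S hlt)] at hd
      have := hD.ac (i+1) hlt hd
      omega
    · omega
  · intro i h1 hi hd
    rw [hG _ _ (dC m n S) (rC m n S), hG _ _ (dA' m n S h1 hi) (rA' m n S h1 hi)] at hd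
    exact absurd Iff.rfl hd
  · intro i hi T hne hT hd
    rcases hi.lt_or_eq with hlt | rfl
    · obtain ⟨H, a, b⟩ := hD.ab (i+1) hlt T hne hT (fun j hj => by
        have := hd j hj
        rwa [hG _ _ (dA m n S hi) (rA m n S hlt),
          hG _ _ (dB m n S (hT j hj).1 (hT j hj).2 hi) (rB m n S (hT j hj).1 (hT j hj).2 hlt)]
          at this)
      exact ⟨H, a, by omega⟩
    · obtain ⟨j, hj⟩ := hne
      have := hd j hj
      rw [hG _ _ (dA m i S hi) (rAn m i S),
          hG _ _ (dB m i S (hT j hj).1 (hT j hj).2 hi) (rBn m i S (hT j hj).1 (hT j hj).2)]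
          at this
      exact absurd Iff.rfl this
  · intro i h1 hi T hne hT hd
    obtain ⟨j, hj⟩ := hne
    have := hd j hj
    rw [hG _ _ (dA' m n S h1 hi) (rA' m n S h1 hi),
        hG _ _ (dB' m n S (hT j hj).1.1 (hT j hj).1.2 h1 hi (hT j hj).2)
          (rB' m n S (hT j hj).1.1 (hT j hj).1.2 h1 hi (hT j hj).2)] at this
    exact absurd Iff.rfl this

theorem size_pos (D : ALC) : 1 ≤ D.size := by
  cases D <;> simp [ALC.size]

theorem cl_s {D G : ALC} (hD : Cl m n S D) (hG : Modal (Iinterp m n S) 1 D G) :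
    Cl m n S G := by
  obtain ⟨hG, hs⟩ := hG
  refine ⟨?_, ?_, ?_, ?_⟩
  · intro i hi hd
    rw [hG _ _ (dC m n S) (sC m n S)] at hd
    rcases hi.lt_or_eq with hlt | rfl
    · rw [hG _ _ (dA m n S hi) (sA m n S hlt)] at hd
      have := hD.ac' (i+1) (by omega) hlt hd
      omega
    · omega
  · intro i h1 hi hd
    rw [hG _ _ (dC m n S) (sC m n S), hG _ _ (dA' m n S h1 hi) (sA' m n S h1 hi)] at hd
    have := hD.ac i hi hd
    omega
  · intro i hi T hne hT hd
    rcases hi.lt_or_eq with hlt | rfl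
    · by_cases hT' : {j ∈ T | i + 1 ∉ S j}.Nonempty
      · obtain ⟨H, a, b⟩ := hD.ab' (i+1) (by omega) hlt _ hT'
          (fun j hj => ⟨hT j hj.1, hj.2⟩) (fun j hj => by
            have := hd j hj.1
            have h2 := hT j hj.1
            rwa [hG _ _ (dA m n S hi) (sA m n S hlt),
              hG _ _ (dB m n S h2.1 h2.2 hi) (sB m n S h2.1 h2.2 hlt hj.2)]
              at this)
        refine ⟨insert (i+1) H, fun j hj => ?_, ?_⟩
        · by_cases hm : i + 1 ∈ S j
          · exact ⟨i+1, Finset.mem_insert_self _ _, hm⟩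
          · obtain ⟨x, hx, hx'⟩ := a j ⟨hj, hm⟩
            exact ⟨x, Finset.mem_insert_of_mem hx, hx'⟩
        · have := Finset.card_insert_le (i+1) H
          omega
      · have hall : ∀ j ∈ T, i + 1 ∈ S j := fun j hj => by
          by_contra hm
          exact hT' ⟨j, hj, hm⟩
        refine ⟨{i+1}, fun j hj => ⟨i+1, by simp, hall j hj⟩, ?_⟩
        obtain ⟨j, hj⟩ := hne
        have := hd j hj
        have h2 := hT j hj
        rw [hG _ _ (dA m n S hi) (sA m n S hlt),
              hG _ _ (dB m n S h2.1 h2.2 hi) (sBc m n S h2.1 h2.2 hlt (hall j hj))]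
              at this
        have := hD.ac' (i+1) (by omega) hlt this
        simp; omega
    · obtain ⟨j, hj⟩ := hne
      have := hd j hj
      rw [hG _ _ (dA m i S hi) (sAn m i S),
          hG _ _ (dB m i S (hT j hj).1 (hT j hj).2 hi) (sBn m i S (hT j hj).1 (hT j hj).2)]
          at this
      exact absurd Iff.rfl this
  · intro i h1 hi T hne hT hd
    obtain ⟨H, a, b⟩ := hD.ab i hi T hne (fun j hj => (hT j hj).1) (fun j hj => by
      have := hd j hj
      rwa [hG _ _ (dA' m n S h1 hi) (sA' m n S h1 hi),
        hG _ _ (dB' m n S (hT j hj).1.1 (hT j hj).1.2 h1 hi (hT j hj).2)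
          (sB' m n S (hT j hj).1.1 (hT j hj).1.2 h1 hi (hT j hj).2)] at this)
    exact ⟨H, a, by omega⟩

theorem cl_all (D : ALC) : Cl m n S D := by
  induction D with
  | bot => exact cl_const _ False (by simp [ALC.sem])
  | top => exact cl_const _ True (fun x hx _ => by simp [ALC.sem, hx])
  | atom a => exact cl_atom a
  | neg c ih => exact cl_neg ih
  | inter c d ihc ihd =>
    exact cl_bin ihc ihd rfl (fun x y => by simp only [ALC.sem, Set.mem_inter_iff]; tauto)
  | union c d ihc ihd =>
    exact cl_bin ihc ihd rfl (fun x y => by simp only [ALC.sem, Set.mem_union]; tauto)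
  | all t c ih =>
    by_cases h0 : t = 0
    · subst h0; exact cl_r ih (modal_all _ _ _)
    by_cases h1 : t = 1
    · subst h1; exact cl_s ih (modal_all _ _ _)
    refine cl_const _ True (fun x hx _ => ?_)
    have : (Iinterp m n S).rI t = ∅ := by simp [Iinterp, h0, h1]
    simp [ALC.sem, this, hx]
  | ex t c ih =>
    by_cases h0 : t = 0
    · subst h0; exact cl_r ih (modal_ex _ _ _)
    by_cases h1 : t = 1
    · subst h1; exact cl_s ih (modal_ex _ _ _)
    refine cl_const _ False (fun x hx _ => ?_)
    have : (Iinterp m n S).rI t = ∅ := by simp [Iinterp, h0, h1]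
    simp [ALC.sem, this]

theorem dom_IJ {x : ℕ} (hx : x ∈ Jdom m n S) (hb : x ≠ eB) : x ∈ (Iinterp m n S).dom := by
  simp [Iinterp, Idom, hx, hb]

theorem cI_IJ {x : ℕ} (hx : x ∈ Jdom m n S) (a : ℕ) :
    x ∈ (Iinterp m n S).cI a ↔ x ∈ (Jinterp m n S).cI a := by
  by_cases ha : a = 0
  · have : x ≠ eAA n := by
      rintro rfl
      simp [Jdom, eB, eBB, eBB', eC, eAA, el_inj] at hx
    simp [Iinterp, Jinterp, ha, this]
  · simp [Iinterp, Jinterp, ha]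

theorem rI_IJ {x : ℕ} (hx : x ∈ Jdom m n S) (hb : x ≠ eB) (t e : ℕ) :
    (x, e) ∈ (Iinterp m n S).rI t ↔ (x, e) ∈ (Jinterp m n S).rI t := by
  have h1 : ∀ i, x ≠ eAA i := by
    rintro i rfl
    simp [Jdom, eB, eBB, eBB', eC, eAA, el_inj] at hx
  have h2 : ∀ i, x ≠ eAA' i := by
    rintro i rfl
    simp [Jdom, eB, eBB, eBB', eC, eAA', el_inj] at hx
  have h3 : x ≠ eA := by
    rintro rfl
    simp [Jdom, eB, eBB, eBB', eC, eA, el_inj] at hx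
  simp only [Iinterp, Jinterp]
  split_ifs
  · simp [IrPairs, JrPairs, h1, h2, h3, hb]
  · simp [IsPairs, h1, h2]
  · simp

theorem rI_J_dom {x e t : ℕ} (h : (x, e) ∈ (Jinterp m n S).rI t) :
    e ∈ Jdom m n S ∧ e ≠ eB := by
  simp only [Jinterp] at h
  split_ifs at h
  · simp only [JrPairs, JrCore, Set.mem_union, Set.mem_setOf_eq, Prod.mk.injEq,
      Set.mem_singleton_iff] at h
    simp only [Jdom, Set.mem_union, Set.mem_setOf_eq, Set.mem_singleton_iff]
    rcases h with ⟨j, h1, h2, -, rfl⟩ | (((⟨j, i, h1, h2, h3, h4, -, rfl⟩ | ⟨j, i, _, _, _, _, _, _, rfl⟩) | ⟨j, _, _, _, rfl⟩) | ⟨_, rfl⟩)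
    · exact ⟨.inl (.inl (.inr ⟨j, 0, h1, h2, by omega, rfl⟩)), by simp [eBB, eB, el_inj]⟩
    · exact ⟨.inl (.inl (.inr ⟨j, i, h1, h2, by omega, rfl⟩)), by simp [eBB, eB, el_inj]⟩
    all_goals exact ⟨.inr rfl, by simp [eC, eB, el_inj]⟩
  · simp only [JsPairs, Set.mem_union, Set.mem_setOf_eq, Prod.mk.injEq,
      Set.mem_singleton_iff] at h
    simp only [Jdom, Set.mem_union, Set.mem_setOf_eq, Set.mem_singleton_iff]
    rcases h with ((⟨j, i, h1, h2, h3, h4, h5, ⟨-, rfl⟩ | ⟨-, rfl⟩⟩ | ⟨j, i, _, _, _, _, _, _, rfl⟩) | ⟨j, _, _, _, rfl⟩) | ⟨_, rfl⟩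
    · exact ⟨.inl (.inr ⟨j, i, h1, h2, h3, h4, h5, rfl⟩), by simp [eBB', eB, el_inj]⟩
    · exact ⟨.inl (.inl (.inr ⟨j, i, h1, h2, by omega, rfl⟩)), by simp [eBB, eB, el_inj]⟩
    all_goals exact ⟨.inr rfl, by simp [eC, eB, el_inj]⟩
  · simp at h

theorem sem_IJ (D : ALC) : ∀ x ∈ Jdom m n S, x ≠ eB →
    (x ∈ D.sem (Iinterp m n S) ↔ x ∈ D.sem (Jinterp m n S)) := by
  induction D with
  | bot => intro x hx hb; simp [ALC.sem]
  | top => intro x hx hb; exact iff_of_true (dom_IJ hx hb) hx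
  | atom a => intro x hx hb; exact cI_IJ hx a
  | neg c ih =>
    intro x hx hb
    have hx' : x ∈ (Jinterp m n S).dom := hx
    simp [ALC.sem, dom_IJ hx hb, hx', ih x hx hb]
  | inter c d ihc ihd => intro x hx hb; simp [ALC.sem, ihc x hx hb, ihd x hx hb]
  | union c d ihc ihd => intro x hx hb; simp [ALC.sem, ihc x hx hb, ihd x hx hb]
  | all t c ih =>
    intro x hx hb
    have hx' : x ∈ (Jinterp m n S).dom := hx
    simp only [ALC.sem, Set.mem_setOf_eq, dom_IJ hx hb, hx', true_and, rI_IJ hx hb]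
    refine forall_congr' fun e => forall_congr' fun he => ?_
    exact ih e (rI_J_dom he).1 (rI_J_dom he).2
  | ex t c ih =>
    intro x hx hb
    simp only [ALC.sem, Set.mem_setOf_eq, rI_IJ hx hb]
    refine exists_congr fun e => and_congr_right fun he => ?_
    exact ih e (rI_J_dom he).1 (rI_J_dom he).2

theorem succ_a (t e : ℕ) : (eA, e) ∈ (Iinterp m n S).rI t ↔
    t = 0 ∧ (e = eAA 0 ∨ ∃ j, 1 ≤ j ∧ j ≤ m ∧ e = eBB j 0) := by
  simp only [Iinterp]
  split_ifs with h h'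
  · simp [h, IrPairs, JrCore, eBB, eBB', eC, eA, eAA, eAA', el_inj, Prod.ext_iff]
  · simp [h, IsPairs, JsPairs, eBB, eBB', eC, eA, eAA, eAA', el_inj, Prod.ext_iff]
  · simp [h]

theorem succ_b (t e : ℕ) : (eB, e) ∈ (Jinterp m n S).rI t ↔
    t = 0 ∧ (∃ j, 1 ≤ j ∧ j ≤ m ∧ e = eBB j 0) := by
  simp only [Jinterp]
  split_ifs with h h'
  · simp [h, JrPairs, JrCore, eB, eBB, eBB', eC, eA, eAA, eAA', el_inj, Prod.ext_iff]
  · simp [h, JsPairs, eB, eBB, eBB', eC, eA, eAA, eAA', el_inj, Prod.ext_iff]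
  · simp [h]

theorem sem_b0 (D : ALC) {j : ℕ} (h1 : 1 ≤ j) (h2 : j ≤ m) :
    eBB j 0 ∈ D.sem (Jinterp m n S) ↔ eBB j 0 ∈ D.sem (Iinterp m n S) := by
  refine (sem_IJ D _ ?_ ?_).symm
  · exact .inl (.inl (.inr ⟨j, 0, h1, h2, by omega, rfl⟩))
  · simp [eBB, eB, el_inj]

theorem top_level (C : ALC)
    (h : ¬ (eA ∈ C.sem (Iinterp m n S) ↔ eB ∈ C.sem (Jinterp m n S))) :
    ∃ D : ALC, D.size + 1 ≤ C.size ∧ ∀ j, 1 ≤ j → j ≤ m →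
      ¬ (eAA 0 ∈ D.sem (Iinterp m n S) ↔ eBB j 0 ∈ D.sem (Iinterp m n S)) := by
  have hda : eA ∈ (Iinterp m n S).dom := by simp [Iinterp, Idom]
  have hdb : eB ∈ (Jinterp m n S).dom := by simp [Jinterp, Jdom]
  induction C with
  | bot => simp [ALC.sem] at h
  | top => simp [ALC.sem, hda, hdb] at h
  | atom a =>
    exfalso; apply h
    by_cases ha : a = 0 <;>
      simp [ALC.sem, Iinterp, Jinterp, ha, eA, eB, eBB, eAA, el_inj]
  | neg c ih =>
    obtain ⟨D, h1, h2⟩ := ih (by simp [ALC.sem, hda, hdb] at h; tauto)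
    exact ⟨D, by simp only [ALC.size]; omega, h2⟩
  | inter c d ihc ihd =>
    have : ¬ (eA ∈ c.sem (Iinterp m n S) ↔ eB ∈ c.sem (Jinterp m n S)) ∨
      ¬ (eA ∈ d.sem (Iinterp m n S) ↔ eB ∈ d.sem (Jinterp m n S)) := by
      simp only [ALC.sem, Set.mem_inter_iff] at h; tauto
    rcases this with h' | h'
    · obtain ⟨D, h1, h2⟩ := ihc h'
      exact ⟨D, by simp only [ALC.size]; omega, h2⟩
    · obtain ⟨D, h1, h2⟩ := ihd h'
      exact ⟨D, by simp only [ALC.size]; omega, h2⟩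
  | union c d ihc ihd =>
    have : ¬ (eA ∈ c.sem (Iinterp m n S) ↔ eB ∈ c.sem (Jinterp m n S)) ∨
      ¬ (eA ∈ d.sem (Iinterp m n S) ↔ eB ∈ d.sem (Jinterp m n S)) := by
      simp only [ALC.sem, Set.mem_union] at h; tauto
    rcases this with h' | h'
    · obtain ⟨D, h1, h2⟩ := ihc h'
      exact ⟨D, by simp only [ALC.size]; omega, h2⟩
    · obtain ⟨D, h1, h2⟩ := ihd h'
      exact ⟨D, by simp only [ALC.size]; omega, h2⟩
  | all t c _ =>
    refine ⟨c, le_rfl, fun j h1 h2 hiff => h ?_⟩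
    simp only [ALC.sem, Set.mem_setOf_eq, hda, hdb, true_and, succ_a, succ_b]
    constructor
    · rintro H e ⟨ht, j', a, b, rfl⟩
      exact (sem_b0 c a b).2 (H _ ⟨ht, .inr ⟨j', a, b, rfl⟩⟩)
    · rintro H e ⟨ht, rfl | ⟨j', a, b, rfl⟩⟩
      · exact hiff.2 ((sem_b0 c h1 h2).1 (H _ ⟨ht, j, h1, h2, rfl⟩))
      · exact (sem_b0 c a b).1 (H _ ⟨ht, j', a, b, rfl⟩)
  | ex t c _ =>
    refine ⟨c, le_rfl, fun j h1 h2 hiff => h ?_⟩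
    simp only [ALC.sem, Set.mem_setOf_eq, succ_a, succ_b]
    constructor
    · rintro ⟨e, ⟨ht, rfl | ⟨j', a, b, rfl⟩⟩, he⟩
      · exact ⟨_, ⟨ht, j, h1, h2, rfl⟩, (sem_b0 c h1 h2).2 (hiff.1 he)⟩
      · exact ⟨_, ⟨ht, j', a, b, rfl⟩, (sem_b0 c a b).2 he⟩
    · rintro ⟨e, ⟨ht, j', a, b, rfl⟩, he⟩
      exact ⟨_, ⟨ht, .inr ⟨j', a, b, rfl⟩⟩, (sem_b0 c a b).1 he⟩

end

/-- If there is an ALC concept of size at most k' = n + k + 2 that fits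
P = {(I,a)}, N = {(J,b)}, then {S₁,…,S_m} has a hitting set of size at most k. -/
theorem statement6 (m n k : ℕ) (S : ℕ → Set ℕ)
    (hS : ∀ j, 1 ≤ j → j ≤ m → S j ⊆ Set.Icc 1 n)
    (hcov : ⋃ j ∈ Set.Icc 1 m, S j = Set.Icc 1 n)
    (h : ∃ C : ALC, C.size ≤ n + k + 2 ∧
      Fits C {(Iinterp m n S, eA)} {(Jinterp m n S, eB)}) :
    ∃ H : Finset ℕ, H.card ≤ k ∧ ∀ j, 1 ≤ j → j ≤ m → ∃ x ∈ H, x ∈ S j := by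
  obtain ⟨C, hsz, hP, hN⟩ := h
  have hP := hP _ rfl
  have hN := hN _ rfl
  simp only at hP hN
  obtain ⟨D, h1, h2⟩ := top_level C (fun hiff => hN (hiff.1 hP))
  by_cases hm : m = 0
  · exact ⟨∅, by simp, fun j a b => by omega⟩
  obtain ⟨H, a, b⟩ := (cl_all D).ab 0 (Nat.zero_le n) (Set.Icc 1 m) ⟨1, by simp; omega⟩
    (fun j hj => hj) (fun j hj => h2 j hj.1 hj.2)
  exact ⟨H, by omega, fun j h1 h2 => a j ⟨h1, h2⟩⟩


end ALCPaper
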